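/- Let A be any subset of the space M of codes of strict total orders on ℕ, and for η ∈ M let S_A(η) := {σ ∈ S∞ : σ • η ∈ A}, where S∞ = Equiv.Perm ℕ acts by (σ • ξ)(x, y) = ξ(σ⁻¹ x, σ⁻¹ y). Let η₁, η₂ ∈ M be such that the orders they code are decidable (their characteristic functions ℕ × ℕ → Bool are computable), dense, and without least or greatest element. Then there exists a permutation π of ℕ, with π and π⁻¹ computable, such that S_A(η₂) = S_A(η₁) · π⁻¹ = {σ * π⁻¹ : σ ∈ S_A(η₁)}. -/

import Mathlib

/-- `ξ : ℕ × ℕ → Bool` codes a strict total (linear) order on `ℕ`. -/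
def IsTotalOrderCode (ξ : ℕ × ℕ → Bool) : Prop :=
  (∀ x : ℕ, ξ (x, x) = false) ∧
  (∀ x y : ℕ, x ≠ y → Xor' (ξ (x, y) = true) (ξ (y, x) = true)) ∧
  (∀ x y z : ℕ, ξ (x, y) = true → ξ (y, z) = true → ξ (x, z) = true)

/-- The space `M` of codes of strict total orders on `ℕ`. -/
def M : Set (ℕ × ℕ → Bool) := {ξ | IsTotalOrderCode ξ}

/-- The logical action of `S∞ = Equiv.Perm ℕ` on `ℕ × ℕ → Bool`:
`(σ • ξ)(x, y) = ξ(σ⁻¹ x, σ⁻¹ y)`. -/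
def permSMul (σ : Equiv.Perm ℕ) (ξ : ℕ × ℕ → Bool) : ℕ × ℕ → Bool :=
  fun p => ξ (σ.symm p.1, σ.symm p.2)

namespace Computable

variable {α β : Type*} [Primcodable α] [Primcodable β]

theorem list_all {l : α → List β} {p : α → β → Bool} (hl : Computable l) (hp : Computable₂ p) :
    Computable fun a => (l a).all (p a) := by
  have hstep : Computable₂ fun (a : α) (s : ℕ × Bool) =>
      s.2 && (((l a)[s.1]?).map (p a)).getD true :=
    Primrec.and.to_comp.comp (snd.comp snd)
      (option_getD
        (option_map (list_getElem?.comp (hl.comp fst) (fst.comp snd))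
          (hp.comp (fst.comp fst) snd).to₂)
        (const true))
  refine (nat_rec (list_length.comp hl) (const true) hstep).of_eq fun a => ?_
  have key : ∀ n, (Nat.rec true
      (fun i b => b && (((l a)[i]?).map (p a)).getD true) n : Bool) = ((l a).take n).all (p a) := by
    intro n
    induction n with
    | zero => simp
    | succ n ih =>
      simp only [ih, List.take_add_one, List.all_append]
      cases (l a)[n]? <;> simp
  simpa using key (l a).length

theorem exists_choice {p : α → ℕ → Bool} (hp : Computable₂ p) (h : ∀ a, ∃ n, p a n = true) :
    ∃ f : α → ℕ, Computable f ∧ ∀ a, p a (f a) = true := by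
  classical
  refine ⟨fun a => Nat.find (h a), (Partrec.rfind hp.partrec₂).of_eq_tot fun a => ?_,
    fun a => Nat.find_spec (h a)⟩
  refine Nat.mem_rfind.2 ⟨?_, fun hm => ?_⟩
  · simpa using (Nat.find_spec (h a)).symm
  · simpa using (Nat.find_min (h a) hm)

end Computable

theorem exists_between_finsets_of_isStrictTotalOrder {α : Type*} [Nonempty α]
    (r : α → α → Prop) [IsStrictTotalOrder α r] (hdense : ∀ x y, r x y → ∃ z, r x z ∧ r z y)
    (hnoleast : ∀ x, ∃ y, r y x) (hnogreatest : ∀ x, ∃ y, r x y) (lo hi : Finset α)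
    (hlt : ∀ x ∈ lo, ∀ y ∈ hi, r x y) : ∃ m, (∀ x ∈ lo, r x m) ∧ ∀ y ∈ hi, r m y := by
  classical
  let := linearOrderOfSTO r
  have : DenselyOrdered α := ⟨hdense⟩
  have : NoMinOrder α := ⟨hnoleast⟩
  have : NoMaxOrder α := ⟨hnogreatest⟩
  exact Order.exists_between_finsets lo hi hlt

namespace IsTotalOrderCode

variable {ξ : ℕ × ℕ → Bool}

theorem asymm (h : IsTotalOrderCode ξ) {x y : ℕ} (hxy : ξ (x, y) = true) : ξ (y, x) = false := by
  by_contra hyx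
  have := h.2.2 x y x hxy (by simpa using hyx)
  simp [h.1] at this

theorem eq_or_lt_or_gt (h : IsTotalOrderCode ξ) (x y : ℕ) :
    x = y ∨ ξ (x, y) = true ∨ ξ (y, x) = true := by
  by_cases hxy : x = y
  · exact Or.inl hxy
  · exact Or.inr ((h.2.1 x y hxy).imp And.left And.left)

theorem eq_of_not_lt (h : IsTotalOrderCode ξ) {x y : ℕ} (hxy : ξ (x, y) = false)
    (hyx : ξ (y, x) = false) : x = y := by
  have := h.eq_or_lt_or_gt x y
  simp_all

theorem isStrictTotalOrder (h : IsTotalOrderCode ξ) :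
    IsStrictTotalOrder ℕ fun x y => ξ (x, y) = true where
  trichotomous x y hxy hyx := h.eq_of_not_lt (by simpa using hxy) (by simpa using hyx)
  irrefl x := by simp [h.1]
  trans := h.2.2

theorem exists_between_finsets (h : IsTotalOrderCode ξ)
    (hdense : ∀ x y : ℕ, ξ (x, y) = true → ∃ z, ξ (x, z) = true ∧ ξ (z, y) = true)
    (hnoleast : ∀ x : ℕ, ∃ y, ξ (y, x) = true) (hnogreatest : ∀ x : ℕ, ∃ y, ξ (x, y) = true)
    (lo hi : Finset ℕ) (hlt : ∀ x ∈ lo, ∀ y ∈ hi, ξ (x, y) = true) :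
    ∃ m, (∀ x ∈ lo, ξ (x, m) = true) ∧ ∀ y ∈ hi, ξ (m, y) = true := by
  have := h.isStrictTotalOrder
  exact exists_between_finsets_of_isStrictTotalOrder _ hdense hnoleast hnogreatest lo hi hlt

end IsTotalOrderCode

/-- The pairs listed in `L` form a partial isomorphism from the order coded by `ξ` to the one
coded by `ζ`. -/
def isPartialIso (ξ ζ : ℕ × ℕ → Bool) (L : List (ℕ × ℕ)) : Bool :=
  L.all fun p => L.all fun q => ξ (p.1, q.1) == ζ (p.2, q.2)

section PartialIso

variable {ξ ζ : ℕ × ℕ → Bool} {L : List (ℕ × ℕ)}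

theorem isPartialIso_iff :
    isPartialIso ξ ζ L = true ↔ ∀ p ∈ L, ∀ q ∈ L, ξ (p.1, q.1) = ζ (p.2, q.2) := by
  simp only [isPartialIso, List.all_eq_true, beq_iff_eq]

theorem isPartialIso_map_swap (h : isPartialIso ξ ζ L = true) :
    isPartialIso ζ ξ (L.map Prod.swap) = true := by
  rw [isPartialIso_iff] at h ⊢
  simp only [List.forall_mem_map, Prod.fst_swap, Prod.snd_swap]
  exact fun p hp q hq => (h p hp q hq).symm

theorem computable_isPartialIso (hξ : Computable ξ) (hζ : Computable ζ) :
    Computable (isPartialIso ξ ζ) := by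
  have h : Computable fun s : (List (ℕ × ℕ) × (ℕ × ℕ)) × (ℕ × ℕ) =>
      ξ (s.1.2.1, s.2.1) == ζ (s.1.2.2, s.2.2) :=
    Primrec.beq.to_comp.comp
      (hξ.comp (.pair (.comp .fst (.comp .snd .fst)) (.comp .fst .snd)))
      (hζ.comp (.pair (.comp .snd (.comp .snd .fst)) (.comp .snd .snd)))
  exact Computable.list_all .id (Computable.list_all .fst h.to₂).to₂

theorem exists_isPartialIso_cons (hξ : IsTotalOrderCode ξ) (hζ : IsTotalOrderCode ζ)
    (hdense : ∀ x y : ℕ, ζ (x, y) = true → ∃ z, ζ (x, z) = true ∧ ζ (z, y) = true)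
    (hnoleast : ∀ x : ℕ, ∃ y, ζ (y, x) = true) (hnogreatest : ∀ x : ℕ, ∃ y, ζ (x, y) = true)
    (hL : isPartialIso ξ ζ L = true) (x : ℕ) :
    ∃ y, isPartialIso ξ ζ ((x, y) :: L) = true := by
  simp only [isPartialIso_iff] at hL ⊢
  suffices ∃ y, ∀ p ∈ L, ξ (x, p.1) = ζ (y, p.2) ∧ ξ (p.1, x) = ζ (p.2, y) by
    obtain ⟨y, hy⟩ := this
    refine ⟨y, List.forall_mem_cons.2 ⟨List.forall_mem_cons.2 ⟨?_, fun q hq => (hy q hq).1⟩,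
      fun p hp => List.forall_mem_cons.2 ⟨(hy p hp).2, hL p hp⟩⟩⟩
    simp [hξ.1, hζ.1]
  by_cases hx : ∃ p ∈ L, p.1 = x
  · obtain ⟨p, hp, rfl⟩ := hx
    exact ⟨p.2, fun q hq => ⟨hL p hp q hq, hL q hq p hp⟩⟩
  · push Not at hx
    obtain ⟨y, hlo, hhi⟩ := hζ.exists_between_finsets hdense hnoleast hnogreatest
      ((L.filter fun p => ξ (p.1, x)).map Prod.snd).toFinset
      ((L.filter fun p => ξ (x, p.1)).map Prod.snd).toFinset (by
        simp only [List.mem_toFinset, List.forall_mem_map, List.mem_filter]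
        rintro p ⟨hp, hpx⟩ q ⟨hq, hxq⟩
        rw [← hL p hp q hq]
        exact hξ.2.2 _ _ _ hpx hxq)
    simp only [List.mem_toFinset, List.forall_mem_map, List.mem_filter] at hlo hhi
    refine ⟨y, fun p hp => ?_⟩
    rcases hξ.eq_or_lt_or_gt p.1 x with h | h | h
    · exact absurd h (hx p hp)
    · have h' := hlo p ⟨hp, h⟩
      rw [h, h', hξ.asymm h, hζ.asymm h']
      exact ⟨rfl, rfl⟩
    · have h' := hhi p ⟨hp, h⟩
      rw [h, h', hξ.asymm h, hζ.asymm h']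
      exact ⟨rfl, rfl⟩

end PartialIso

/-- Two decidable dense orders without endpoints on `ℕ` are computably isomorphic. -/
theorem exists_computable_orderIso {ξ ζ : ℕ × ℕ → Bool}
    (hξ : IsTotalOrderCode ξ) (hζ : IsTotalOrderCode ζ)
    (hcξ : Computable ξ) (hcζ : Computable ζ)
    (hdenseξ : ∀ x y : ℕ, ξ (x, y) = true → ∃ z, ξ (x, z) = true ∧ ξ (z, y) = true)
    (hnoleastξ : ∀ x : ℕ, ∃ y, ξ (y, x) = true)
    (hnogreatestξ : ∀ x : ℕ, ∃ y, ξ (x, y) = true)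
    (hdenseζ : ∀ x y : ℕ, ζ (x, y) = true → ∃ z, ζ (x, z) = true ∧ ζ (z, y) = true)
    (hnoleastζ : ∀ x : ℕ, ∃ y, ζ (y, x) = true)
    (hnogreatestζ : ∀ x : ℕ, ∃ y, ζ (x, y) = true) :
    ∃ π : Equiv.Perm ℕ, Computable (π : ℕ → ℕ) ∧ Computable (π.symm : ℕ → ℕ) ∧
      ∀ x y, ζ (π x, π y) = ξ (x, y) := by
  let ext (L : List (ℕ × ℕ)) (n m : ℕ) : List (ℕ × ℕ) :=
    (m.unpair.2, n) :: (n, m.unpair.1) :: L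
  have hext : Computable fun s : (List (ℕ × ℕ) × ℕ) × ℕ => ext s.1.1 s.1.2 s.2 :=
    Computable.list_cons.comp
      (.pair (.comp .snd (Computable.unpair.comp .snd)) (.comp .snd .fst))
      (Computable.list_cons.comp
        (.pair (.comp .snd .fst) (.comp .fst (Computable.unpair.comp .snd)))
        (.comp .fst .fst))
  have hiso := computable_isPartialIso hcξ hcζ
  -- Allowing any value when `L` is not a partial isomorphism makes the search total.
  obtain ⟨F, hF, hFspec⟩ := Computable.exists_choice
    (p := fun (s : List (ℕ × ℕ) × ℕ) m =>
      isPartialIso ξ ζ (ext s.1 s.2 m) || !isPartialIso ξ ζ s.1)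
    (Primrec.or.to_comp.comp (hiso.comp hext)
      (Primrec.not.to_comp.comp (hiso.comp (.comp .fst .fst)))) (by
      rintro ⟨L, n⟩
      by_cases hL : isPartialIso ξ ζ L = true
      · obtain ⟨y, hy⟩ :=
          exists_isPartialIso_cons hξ hζ hdenseζ hnoleastζ hnogreatestζ hL n
        obtain ⟨x, hx⟩ :=
          exists_isPartialIso_cons hζ hξ hdenseξ hnoleastξ hnogreatestξ
            (isPartialIso_map_swap hy) n
        have hx' := isPartialIso_map_swap hx
        refine ⟨Nat.pair y x, ?_⟩
        simp only [List.map_cons, List.map_map, Prod.swap_swap_eq, List.map_id,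
          Prod.swap_prod_mk] at hx'
        simp [ext, hx']
      · exact ⟨0, by simp [hL]⟩)
  let S (n : ℕ) : List (ℕ × ℕ) := Nat.rec [] (fun k L => ext L k (F (L, k))) n
  have hS : Computable S :=
    Computable.nat_rec .id (.const [])
      (Computable.to₂ (hext.comp (.pair (.pair (.comp .snd .snd) (.comp .fst .snd))
        (hF.comp (.pair (.comp .snd .snd) (.comp .fst .snd))))))
  have hSiso : ∀ n, isPartialIso ξ ζ (S n) = true := by
    intro n
    induction n with
    | zero => rfl
    | succ n ih =>
      have := hFspec (S n, n)
      simpa only [ih, Bool.not_true, Bool.or_false] using this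
  have hSmono : ∀ {m n}, m ≤ n → S m ⊆ S n := by
    intro m n hmn
    induction hmn with
    | refl => exact List.Subset.refl _
    | step _ ih => exact List.subset_cons_of_subset _ (List.subset_cons_of_subset _ ih)
  let f (n : ℕ) : ℕ := (F (S n, n)).unpair.1
  let g (n : ℕ) : ℕ := (F (S n, n)).unpair.2
  have hFS : Computable fun n => (F (S n, n)).unpair :=
    Computable.unpair.comp (hF.comp (hS.pair .id))
  have hf : Computable f := .comp .fst hFS
  have hg : Computable g := .comp .snd hFS
  have hf_mem : ∀ n, (n, f n) ∈ S (n + 1) := fun n => .tail _ (.head _)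
  have hg_mem : ∀ n, (g n, n) ∈ S (n + 1) := fun n => .head _
  clear_value f g S
  have hcompat : ∀ {m n a b c d}, (a, b) ∈ S m → (c, d) ∈ S n → ξ (a, c) = ζ (b, d) := by
    intro m n a b c d hp hq
    exact isPartialIso_iff.1 (hSiso (max m n)) _ (hSmono (le_max_left m n) hp) _
      (hSmono (le_max_right m n) hq)
  have hgf : ∀ n, g (f n) = n := fun n =>
    have hp := hg_mem (f n)
    have hq := hf_mem n
    hξ.eq_of_not_lt ((hcompat hp hq).trans (hζ.1 (f n))) ((hcompat hq hp).trans (hζ.1 (f n)))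
  have hfg : ∀ n, f (g n) = n := fun n =>
    have hp := hf_mem (g n)
    have hq := hg_mem n
    hζ.eq_of_not_lt ((hcompat hp hq).symm.trans (hξ.1 (g n)))
      ((hcompat hq hp).symm.trans (hξ.1 (g n)))
  exact ⟨⟨f, g, hgf, hfg⟩, hf, hg, fun x y => (hcompat (hf_mem x) (hf_mem y)).symm⟩

/-- Let `A ⊆ M` and, for `η ∈ M`, let `S_A(η) = {σ ∈ S∞ : σ • η ∈ A}`. If
`η₁, η₂ ∈ M` code decidable dense orders without endpoints, then there is a permutation `π` of
`ℕ`, computable with computable inverse, with `S_A(η₂) = S_A(η₁) · π⁻¹`. -/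
theorem stmt_12 (A : Set (ℕ × ℕ → Bool)) (hA : A ⊆ M)
    (η₁ η₂ : ℕ × ℕ → Bool) (h₁ : η₁ ∈ M) (h₂ : η₂ ∈ M)
    (hc₁ : Computable η₁) (hc₂ : Computable η₂)
    (hdense₁ : ∀ x y : ℕ, η₁ (x, y) = true → ∃ z, η₁ (x, z) = true ∧ η₁ (z, y) = true)
    (hnoleast₁ : ∀ x : ℕ, ∃ y, η₁ (y, x) = true)
    (hnogreatest₁ : ∀ x : ℕ, ∃ y, η₁ (x, y) = true)
    (hdense₂ : ∀ x y : ℕ, η₂ (x, y) = true → ∃ z, η₂ (x, z) = true ∧ η₂ (z, y) = true)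
    (hnoleast₂ : ∀ x : ℕ, ∃ y, η₂ (y, x) = true)
    (hnogreatest₂ : ∀ x : ℕ, ∃ y, η₂ (x, y) = true) :
    ∃ π : Equiv.Perm ℕ, Computable (π : ℕ → ℕ) ∧ Computable (π.symm : ℕ → ℕ) ∧
      {σ : Equiv.Perm ℕ | permSMul σ η₂ ∈ A} =
        (fun σ : Equiv.Perm ℕ => σ * π⁻¹) '' {σ : Equiv.Perm ℕ | permSMul σ η₁ ∈ A} := by
  obtain ⟨π, hπ, hπ', hiso⟩ := exists_computable_orderIso h₁ h₂ hc₁ hc₂ hdense₁ hnoleast₁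
    hnogreatest₁ hdense₂ hnoleast₂ hnogreatest₂
  have hsmul : ∀ σ : Equiv.Perm ℕ, permSMul (σ * π) η₁ = permSMul σ η₂ := by
    intro σ
    funext p
    have := hiso (π.symm (σ.symm p.1)) (π.symm (σ.symm p.2))
    rw [Equiv.apply_symm_apply, Equiv.apply_symm_apply] at this
    exact this.symm
  refine ⟨π, hπ, hπ', Set.ext fun σ => ⟨fun hσ => ⟨σ * π, ?_, mul_inv_cancel_right σ π⟩, ?_⟩⟩
  · rw [Set.mem_ofPred_eq, hsmul]
    exact hσ
  · rintro ⟨τ, hτ, rfl⟩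
    rw [Set.mem_ofPred_eq, ← hsmul, inv_mul_cancel_right]
    exact hτ
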